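/- Let K_t(x) = (2π)^{−d/2} ∫_{ℝ^d} e^{i x·ξ} e^{−t h(ξ)} dξ be the heat kernel of a strongly elliptic operator of even order m, where Re h(ξ + iη) ≥ λ|ξ|^m − σ|η|^m − ω for all ξ, η ∈ ℝ^d with λ > 0, σ, ω ≥ 0. Then there exist a, b > 0 such that |K_t(x)| ≤ a t^{−d/m} e^{ω t} e^{−b (|x|^m/t)^{1/(m−1)}} for all x ∈ ℝ^d and t > 0. -/

import Mathlib

open scoped BigOperators

/-- The polynomial symbol `h(z) = ∑_{|α| ≤ m} c_α (iz)^α` on `ℂ^d`. -/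
noncomputable def ellipticSymbolC (d m : ℕ) (c : (n : ℕ) → (Fin n → Fin d) → ℂ)
    (z : Fin d → ℂ) : ℂ :=
  ∑ n ∈ Finset.range (m + 1), ∑ α : Fin n → Fin d,
    c n α * ∏ j, (Complex.I * z (α j))

/-- The heat kernel `K_t(x) = (2π)^{-d/2} ∫ e^{i x·ξ} e^{-t h(ξ)} dξ`. -/
noncomputable def heatKernel (d m : ℕ) (c : (n : ℕ) → (Fin n → Fin d) → ℂ)
    (t : ℝ) (x : EuclideanSpace ℝ (Fin d)) : ℂ :=
  (((2 * Real.pi) ^ (-(d : ℝ) / 2) : ℝ) : ℂ) *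
    ∫ ξ : EuclideanSpace ℝ (Fin d),
      Complex.exp (Complex.I * ((∑ i, x i * ξ i : ℝ) : ℂ)) *
        Complex.exp (-(t : ℂ) * ellipticSymbolC d m c (fun i => (ξ i : ℂ)))

open MeasureTheory

/-- Contour shift on `ℝ^d`: the integral of an entire function over `ℝ^d + z η` does not depend on
`z`, provided the translates are dominated locally uniformly in `z`. -/
lemma integral_add_complex_mul_eq {d : ℕ} {F : (Fin d → ℂ) → ℂ} (hF : Differentiable ℂ F)
    (η : EuclideanSpace ℝ (Fin d))
    (hB : ∀ R : ℝ, ∃ B : EuclideanSpace ℝ (Fin d) → ℝ, Integrable B ∧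
      ∀ ξ : EuclideanSpace ℝ (Fin d), ∀ z : ℂ, ‖z‖ ≤ R →
        ‖F (fun i => (ξ i : ℂ) + z * (η i : ℂ))‖ ≤ B ξ) (w : ℂ) :
    ∫ ξ : EuclideanSpace ℝ (Fin d), F (fun i => (ξ i : ℂ) + w * (η i : ℂ)) =
      ∫ ξ : EuclideanSpace ℝ (Fin d), F (fun i => (ξ i : ℂ)) := by
  have hFc : Continuous F := hF.continuous
  set Φ : ℂ → EuclideanSpace ℝ (Fin d) → ℂ :=
    fun z ξ => F (fun i => (ξ i : ℂ) + z * (η i : ℂ)) with hΦ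
  have hcont : ∀ z, Continuous (Φ z) := fun z => by
    simp only [hΦ]; fun_prop
  have hcont_deriv : ∀ z, AEStronglyMeasurable (fun ξ => deriv (fun z => Φ z ξ) z) volume := by
    intro z
    have hu : Continuous (fun ξ z => Φ z ξ).uncurry := by
      simp only [hΦ, Function.uncurry_def]; fun_prop
    exact ((measurable_deriv_with_param hu).comp measurable_prodMk_right).aestronglyMeasurable
  have hdiff : ∀ ξ, Differentiable ℂ (fun z => Φ z ξ) := fun ξ => by
    simp only [hΦ]
    refine hF.comp ?_
    rw [differentiable_pi]
    intro i
    fun_prop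
  have hG : ∀ z₀, HasDerivAt (fun z => ∫ ξ, Φ z ξ)
      (∫ ξ, deriv (fun z => Φ z ξ) z₀) z₀ := by
    intro z₀
    obtain ⟨B, hBi, hBb⟩ := hB (‖z₀‖ + 2)
    refine (hasDerivAt_integral_of_dominated_loc_of_deriv_le (bound := B)
      (Metric.ball_mem_nhds z₀ one_pos) (.of_forall fun z => (hcont z).aestronglyMeasurable)
      (hBi.mono' (hcont z₀).aestronglyMeasurable (.of_forall fun ξ => hBb ξ z₀ (by linarith)))
      (hcont_deriv z₀) (.of_forall fun ξ z hz => ?_) hBi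
      (.of_forall fun ξ z _ => (hdiff ξ z).hasDerivAt)).2
    have := Complex.norm_deriv_le_of_forall_mem_sphere_norm_le (c := z) (R := 1) (C := B ξ)
      one_pos (hdiff ξ).diffContOnCl (fun u hu => hBb ξ u ?_)
    · simpa using this
    · have h1 : ‖u - z‖ = 1 := by simpa [dist_eq_norm] using hu
      have h2 : ‖z - z₀‖ < 1 := by simpa [dist_eq_norm] using hz
      have : u = (u - z) + (z - z₀) + z₀ := by ring
      rw [this]
      linarith [norm_add₃_le (a := u - z) (b := z - z₀) (c := z₀)]
  have htrans : ∀ (z : ℂ) (s : ℝ), ∫ ξ, Φ (s + z) ξ = ∫ ξ, Φ z ξ := by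
    intro z s
    rw [← integral_add_right_eq_self (Φ z) (s • η)]
    refine integral_congr_ae (.of_forall fun ξ => ?_)
    simp only [hΦ]
    congr 1
    ext i
    simp
    ring
  have hzero : ∀ z, deriv (fun z => ∫ ξ, Φ z ξ) z = 0 := by
    intro z
    have h1 : HasDerivAt (fun u : ℂ => ∫ ξ, Φ (u + z) ξ)
        (∫ ξ, deriv (fun z => Φ z ξ) z) ((0 : ℝ) : ℂ) := by
      refine HasDerivAt.comp_add_const (f := fun z => ∫ ξ, Φ z ξ) _ _ ?_
      simpa using hG z
    have h2 := h1.comp_ofReal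
    simp only [htrans] at h2
    rw [(hG z).deriv]
    exact h2.unique (hasDerivAt_const _ _)
  have := is_const_of_deriv_eq_zero (fun z => (hG z).differentiableAt) hzero w 0
  simpa [hΦ] using this

lemma integrable_exp_neg_mul_norm_pow {d m : ℕ} (hm : 2 ≤ m) {c : ℝ} (hc : 0 < c) :
    Integrable (fun ξ : EuclideanSpace ℝ (Fin d) => Real.exp (-c * ‖ξ‖ ^ m)) := by
  have hg : Integrable (fun ξ : EuclideanSpace ℝ (Fin d) => Real.exp (-c * ‖ξ‖ ^ 2)) := by
    have := (GaussianFourier.integrable_cexp_neg_mul_sq_norm_add (V := EuclideanSpace ℝ (Fin d))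
      (b := (c : ℂ)) (by simpa using hc) 0 0).norm
    refine this.congr (.of_forall fun ξ => ?_)
    simp only [Complex.norm_exp]
    congr 1
    simp [← Complex.ofReal_pow]
  refine (hg.const_mul (Real.exp c)).mono' (by fun_prop) (.of_forall fun ξ => ?_)
  rw [Real.norm_of_nonneg (Real.exp_pos _).le, ← Real.exp_add, Real.exp_le_exp]
  have h : ‖ξ‖ ^ 2 ≤ ‖ξ‖ ^ m + 1 := by
    rcases le_total ‖ξ‖ 1 with h | h
    · have := pow_le_one₀ (n := 2) (norm_nonneg ξ) h
      have := pow_nonneg (norm_nonneg ξ) m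
      linarith
    · linarith [pow_le_pow_right₀ h hm]
  nlinarith

lemma integral_exp_neg_mul_norm_pow {d m : ℕ} (hm : 0 < m) (c : ℝ) {t : ℝ} (ht : 0 < t) :
    ∫ ξ : EuclideanSpace ℝ (Fin d), Real.exp (-(t * c) * ‖ξ‖ ^ m) =
      t ^ (-(d : ℝ) / m) * ∫ ξ : EuclideanSpace ℝ (Fin d), Real.exp (-c * ‖ξ‖ ^ m) := by
  have h := Measure.integral_comp_smul (volume : Measure (EuclideanSpace ℝ (Fin d)))
    (fun ξ => Real.exp (-c * ‖ξ‖ ^ m)) (t ^ (1 / (m : ℝ)))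
  have hr : 0 < t ^ (1 / (m : ℝ)) := Real.rpow_pos_of_pos ht _
  have hrm : (t ^ (1 / (m : ℝ))) ^ m = t := by
    rw [one_div, Real.rpow_inv_natCast_pow ht.le hm.ne']
  have hrd : |((t ^ (1 / (m : ℝ))) ^ d)⁻¹| = t ^ (-(d : ℝ) / m) := by
    rw [abs_of_pos (by positivity), ← Real.rpow_natCast, ← Real.rpow_mul ht.le,
      ← Real.rpow_neg ht.le]
    congr 1
    ring
  rw [finrank_euclideanSpace_fin, hrd, smul_eq_mul] at h
  rw [← h]
  congr 1
  ext ξ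
  rw [norm_smul, Real.norm_of_nonneg hr.le, mul_pow, hrm]
  congr 1
  ring

lemma differentiable_ellipticSymbolC (d m : ℕ) (c : (n : ℕ) → (Fin n → Fin d) → ℂ) :
    Differentiable ℂ (ellipticSymbolC d m c) := by
  unfold ellipticSymbolC
  fun_prop

lemma norm_le_of_ellipticSymbolC_re_ge {d m : ℕ} {c : (n : ℕ) → (Fin n → Fin d) → ℂ}
    {lam σ ω : ℝ}
    (hC : ∀ ξ η : EuclideanSpace ℝ (Fin d),
      lam * ‖ξ‖ ^ m - σ * ‖η‖ ^ m - ω ≤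
        (ellipticSymbolC d m c (fun i => (ξ i : ℂ) + Complex.I * (η i : ℂ))).re)
    {t : ℝ} (ht : 0 < t) (x ξ η : EuclideanSpace ℝ (Fin d)) :
    ‖Complex.exp (Complex.I * ∑ i, (x i : ℂ) * ((ξ i : ℂ) + Complex.I * (η i : ℂ))) *
      Complex.exp (-(t : ℂ) *
        ellipticSymbolC d m c (fun i => (ξ i : ℂ) + Complex.I * (η i : ℂ)))‖ ≤
      Real.exp (-inner ℝ x η + σ * t * ‖η‖ ^ m + ω * t) *
        Real.exp (-(t * lam) * ‖ξ‖ ^ m) := by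
  rw [norm_mul, Complex.norm_exp, Complex.norm_exp, ← Real.exp_add, ← Real.exp_add,
    Real.exp_le_exp]
  have h1 : (Complex.I * ∑ i, (x i : ℂ) * ((ξ i : ℂ) + Complex.I * (η i : ℂ))).re =
      -inner ℝ x η := by
    simp [PiLp.inner_apply, mul_comm]
  have h2 := mul_le_mul_of_nonneg_left (hC ξ η) ht.le
  rw [h1, ← Complex.ofReal_neg, Complex.re_ofReal_mul]
  linarith

lemma norm_heatKernel_le {d m : ℕ} (hm : 2 ≤ m) {c : (n : ℕ) → (Fin n → Fin d) → ℂ}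
    {lam σ ω : ℝ} (hlam : 0 < lam) (hσ : 0 ≤ σ)
    (hC : ∀ ξ η : EuclideanSpace ℝ (Fin d),
      lam * ‖ξ‖ ^ m - σ * ‖η‖ ^ m - ω ≤
        (ellipticSymbolC d m c (fun i => (ξ i : ℂ) + Complex.I * (η i : ℂ))).re)
    {t : ℝ} (ht : 0 < t) (x η : EuclideanSpace ℝ (Fin d)) :
    ‖heatKernel d m c t x‖ ≤ (2 * Real.pi) ^ (-(d : ℝ) / 2) *
      (Real.exp (-inner ℝ x η + σ * t * ‖η‖ ^ m + ω * t) *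
        (t ^ (-(d : ℝ) / m) *
          ∫ ξ : EuclideanSpace ℝ (Fin d), Real.exp (-lam * ‖ξ‖ ^ m))) := by
  set F : (Fin d → ℂ) → ℂ := fun ζ => Complex.exp (Complex.I * ∑ i, (x i : ℂ) * ζ i) *
    Complex.exp (-(t : ℂ) * ellipticSymbolC d m c ζ) with hFdef
  have hF : Differentiable ℂ F := by
    have := differentiable_ellipticSymbolC d m c
    simp only [hFdef]
    fun_prop
  have hB : ∀ R : ℝ, ∃ B : EuclideanSpace ℝ (Fin d) → ℝ, Integrable B ∧
      ∀ ξ : EuclideanSpace ℝ (Fin d), ∀ z : ℂ, ‖z‖ ≤ R →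
        ‖F (fun i => (ξ i : ℂ) + z * (η i : ℂ))‖ ≤ B ξ := by
    intro R
    refine ⟨fun ξ => Real.exp (R * |inner ℝ x η| + σ * t * (R * ‖η‖) ^ m + ω * t +
      t * lam * (R * ‖η‖) ^ m) * Real.exp (-(t * lam / 2 ^ (m - 1)) * ‖ξ‖ ^ m),
      (integrable_exp_neg_mul_norm_pow hm (by positivity)).const_mul _, fun ξ z hz => ?_⟩
    have hz1 : |z.re| ≤ R := (Complex.abs_re_le_norm z).trans hz
    have hz2 : |z.im| ≤ R := (Complex.abs_im_le_norm z).trans hz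
    have hR : 0 ≤ R := (abs_nonneg _).trans hz1
    have harg : (fun i => (ξ i : ℂ) + z * (η i : ℂ)) =
        fun i => (((ξ + z.re • η) i : ℝ) : ℂ) + Complex.I * (((z.im • η) i : ℝ) : ℂ) := by
      ext i
      conv_lhs => rw [← Complex.re_add_im z]
      simp only [PiLp.add_apply, PiLp.smul_apply, smul_eq_mul, Complex.ofReal_add,
        Complex.ofReal_mul]
      ring
    rw [harg]
    refine (norm_le_of_ellipticSymbolC_re_ge hC ht x (ξ + z.re • η) (z.im • η)).trans ?_
    beta_reduce
    rw [← Real.exp_add, ← Real.exp_add, Real.exp_le_exp]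
    have h1 : -inner ℝ x (z.im • η) ≤ R * |inner ℝ x η| := by
      rw [inner_smul_right]
      refine (neg_le_abs _).trans ?_
      rw [abs_mul]
      gcongr
    have h2 : ‖z.im • η‖ ^ m ≤ (R * ‖η‖) ^ m := by
      rw [norm_smul, Real.norm_eq_abs]
      gcongr
    have h3 : ‖ξ‖ ^ m ≤ 2 ^ (m - 1) * (‖ξ + z.re • η‖ ^ m + (R * ‖η‖) ^ m) := by
      refine le_trans ?_ (add_pow_le (norm_nonneg _) (by positivity) m)
      gcongr
      calc ‖ξ‖ = ‖(ξ + z.re • η) - z.re • η‖ := by simp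
        _ ≤ ‖ξ + z.re • η‖ + ‖z.re • η‖ := norm_sub_le _ _
        _ ≤ _ := by rw [norm_smul, Real.norm_eq_abs]; gcongr
    have h4 : σ * t * ‖z.im • η‖ ^ m ≤ σ * t * (R * ‖η‖) ^ m := by gcongr
    have h5 : t * lam / 2 ^ (m - 1) * ‖ξ‖ ^ m ≤
        t * lam * (‖ξ + z.re • η‖ ^ m + (R * ‖η‖) ^ m) := by
      rw [div_mul_eq_mul_div, div_le_iff₀ (by positivity)]
      calc _ ≤ t * lam * (2 ^ (m - 1) * (‖ξ + z.re • η‖ ^ m + (R * ‖η‖) ^ m)) := by gcongr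
        _ = _ := by ring
    linarith
  have hshift := integral_add_complex_mul_eq hF η hB Complex.I
  have hK : heatKernel d m c t x = (((2 * Real.pi) ^ (-(d : ℝ) / 2) : ℝ) : ℂ) *
      ∫ ξ : EuclideanSpace ℝ (Fin d), F (fun i => (ξ i : ℂ) + Complex.I * (η i : ℂ)) := by
    rw [hshift]
    simp [heatKernel, hFdef]
  rw [hK, norm_mul, Complex.norm_real, Real.norm_of_nonneg (by positivity)]
  gcongr
  rw [← integral_exp_neg_mul_norm_pow (by lia) lam ht, ← integral_const_mul]
  refine norm_integral_le_of_norm_le ?_ (.of_forall fun ξ =>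
    norm_le_of_ellipticSymbolC_re_ge hC ht x ξ η)
  exact (integrable_exp_neg_mul_norm_pow hm (by positivity)).const_mul _

/-- A nearly optimal choice of `ρ` in `-ρ r + σ t ρ ^ m`. -/
lemma exists_neg_mul_add_mul_pow_le {m : ℕ} (hm : 2 ≤ m) {σ r t : ℝ} (hσ : 0 ≤ σ) (hr : 0 ≤ r)
    (ht : 0 < t) :
    ∃ ρ, 0 ≤ ρ ∧ -(ρ * r) + σ * t * ρ ^ m ≤
      -((2 * (σ + 1)) ^ (-(1 / ((m : ℝ) - 1))) / 2) *
        (r ^ m / t) ^ ((1 : ℝ) / ((m : ℝ) - 1)) := by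
  obtain ⟨k, rfl⟩ : ∃ k, m = k + 1 := ⟨m - 1, by lia⟩
  have hk : k ≠ 0 := by lia
  have hkr : ((k + 1 : ℕ) : ℝ) - 1 = k := by push_cast; ring
  rw [hkr, one_div]
  set ρ := (r / (2 * (σ + 1) * t)) ^ ((k : ℝ)⁻¹) with hρ
  have hρ0 : 0 ≤ ρ := by positivity
  have hρk : ρ ^ k = r / (2 * (σ + 1) * t) := Real.rpow_inv_natCast_pow (by positivity) hk
  have hprod : ρ * r =
      (2 * (σ + 1)) ^ (-(k : ℝ)⁻¹) * (r ^ (k + 1) / t) ^ ((k : ℝ)⁻¹) := by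
    rw [Real.rpow_neg (by positivity), ← Real.inv_rpow (by positivity),
      ← Real.mul_rpow (by positivity) (by positivity),
      show (2 * (σ + 1))⁻¹ * (r ^ (k + 1) / t) = r / (2 * (σ + 1) * t) * r ^ k by
        field_simp
        ring,
      Real.mul_rpow (by positivity) (by positivity), Real.pow_rpow_inv_natCast hr hk]
  refine ⟨ρ, hρ0, ?_⟩
  have h1 : σ * t * ρ ^ (k + 1) ≤ ρ * r / 2 := by
    have : (σ + 1) * t * ρ ^ (k + 1) = ρ * r / 2 := by
      rw [pow_succ, hρk]
      field_simp
    rw [← this]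
    gcongr
    linarith
  linarith

theorem stmt8 (d m : ℕ) (hm : 0 < m) (hme : Even m)
    (c : (n : ℕ) → (Fin n → Fin d) → ℂ)
    (lam σ ω : ℝ) (hlam : 0 < lam) (hσ : 0 ≤ σ) (hω : 0 ≤ ω)
    (hC : ∀ ξ η : EuclideanSpace ℝ (Fin d),
      lam * ‖ξ‖ ^ m - σ * ‖η‖ ^ m - ω ≤
        (ellipticSymbolC d m c (fun i => (ξ i : ℂ) + Complex.I * (η i : ℂ))).re) :
    ∃ a > (0 : ℝ), ∃ b > (0 : ℝ), ∀ x : EuclideanSpace ℝ (Fin d), ∀ t > (0 : ℝ),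
      ‖heatKernel d m c t x‖ ≤
        a * t ^ (-(d : ℝ) / m) * Real.exp (ω * t) *
          Real.exp (-b * ((‖x‖ ^ m / t) ^ ((1 : ℝ) / ((m : ℝ) - 1)))) := by
  have hm2 : 2 ≤ m := by
    obtain ⟨k, hk⟩ := hme
    lia
  have hint : 0 < ∫ ξ : EuclideanSpace ℝ (Fin d), Real.exp (-lam * ‖ξ‖ ^ m) :=
    integral_exp_pos (integrable_exp_neg_mul_norm_pow hm2 hlam)
  refine ⟨(2 * Real.pi) ^ (-(d : ℝ) / 2) *
    ∫ ξ : EuclideanSpace ℝ (Fin d), Real.exp (-lam * ‖ξ‖ ^ m), by positivity,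
    (2 * (σ + 1)) ^ (-(1 / ((m : ℝ) - 1))) / 2, by positivity, fun x t ht => ?_⟩
  obtain ⟨η, hη⟩ : ∃ η : EuclideanSpace ℝ (Fin d), -inner ℝ x η + σ * t * ‖η‖ ^ m ≤
      -((2 * (σ + 1)) ^ (-(1 / ((m : ℝ) - 1))) / 2) *
        (‖x‖ ^ m / t) ^ ((1 : ℝ) / ((m : ℝ) - 1)) := by
    obtain ⟨ρ, hρ0, hρ⟩ := exists_neg_mul_add_mul_pow_le hm2 hσ (norm_nonneg x) ht
    refine ⟨(ρ * ‖x‖⁻¹) • x, le_trans ?_ hρ⟩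
    rcases eq_or_ne x 0 with rfl | hx
    · have : 0 ≤ σ * t * ρ ^ m := by positivity
      simpa [hm.ne'] using this
    · have hx' : ‖x‖ ≠ 0 := norm_ne_zero_iff.2 hx
      rw [inner_smul_right, real_inner_self_eq_norm_sq, norm_smul,
        Real.norm_of_nonneg (by positivity), inv_mul_cancel_right₀ hx']
      apply le_of_eq
      field_simp
  refine (norm_heatKernel_le hm2 hlam hσ hC ht x η).trans ?_
  calc _ ≤ (2 * Real.pi) ^ (-(d : ℝ) / 2) *
      (Real.exp (-((2 * (σ + 1)) ^ (-(1 / ((m : ℝ) - 1))) / 2) *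
        (‖x‖ ^ m / t) ^ ((1 : ℝ) / ((m : ℝ) - 1)) + ω * t) *
        (t ^ (-(d : ℝ) / m) *
          ∫ ξ : EuclideanSpace ℝ (Fin d), Real.exp (-lam * ‖ξ‖ ^ m))) := by
        gcongr
    _ = _ := by
        rw [Real.exp_add]
        ring
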